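/- Let A, B ⊊ I be proper subsets such that ℓ(d_B d_A) = |A| + |B| (the product is reduced). Then there exists a residue j ∈ I with j ∉ A and j − 1 ∉ B. -/

import Mathlib

/-- `x : Equiv.Perm ℤ` is an affine permutation in `S̃_{k+1}`: it commutes with
translation by `k+1` and its window sums to `(k+1)(k+2)/2`. -/
def IsAffinePerm (k : ℕ) (x : Equiv.Perm ℤ) : Prop :=
  (∀ i : ℤ, x (i + (k + 1)) = x i + (k + 1)) ∧
  ∑ i ∈ Finset.Icc (1 : ℤ) (k + 1), x i = (k + 1) * (k + 2) / 2

/-- The underlying function of the simple generator `s_i`. -/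
def sAffFun (k : ℕ) (i : ZMod (k + 1)) (j : ℤ) : ℤ :=
  if (j : ZMod (k + 1)) = i then j + 1
  else if (j : ZMod (k + 1)) = i + 1 then j - 1
  else j

theorem sAffFun_invol (k : ℕ) (i : ZMod (k + 1)) (h : ¬ (1 : ZMod (k + 1)) = 0) :
    Function.Involutive (sAffFun k i) := by
  have hne : i + 1 ≠ i := fun hc => h (by
    have h2 : i + 1 = i + 0 := by simpa using hc
    exact add_left_cancel h2)
  intro j
  by_cases h1 : (j : ZMod (k + 1)) = i
  · have e1 : sAffFun k i j = j + 1 := if_pos h1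
    have hj1 : ((j + 1 : ℤ) : ZMod (k + 1)) = i + 1 := by push_cast; rw [h1]
    have e2 : sAffFun k i (j + 1) = j := by
      unfold sAffFun
      rw [if_neg (by rw [hj1]; exact hne), if_pos hj1]
      ring
    rw [e1, e2]
  · by_cases h2 : (j : ZMod (k + 1)) = i + 1
    · have e1 : sAffFun k i j = j - 1 := by unfold sAffFun; rw [if_neg h1, if_pos h2]
      have hj1 : ((j - 1 : ℤ) : ZMod (k + 1)) = i := by push_cast; rw [h2]; ring
      have e2 : sAffFun k i (j - 1) = j := by
        unfold sAffFun; rw [if_pos hj1]; ring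
      rw [e1, e2]
    · have e1 : sAffFun k i j = j := by unfold sAffFun; rw [if_neg h1, if_neg h2]
      rw [e1, e1]

/-- The simple generator `s_i` of the affine symmetric group, as a permutation of `ℤ`:
it interchanges `m(k+1) + ī` and `m(k+1) + ī + 1` for every `m` (when `k ≥ 1`). -/
noncomputable def sAff (k : ℕ) (i : ZMod (k + 1)) : Equiv.Perm ℤ :=
  if h : (1 : ZMod (k + 1)) = 0 then 1 else Function.Involutive.toPerm _ (sAffFun_invol k i h)

/-- The Coxeter length of `x`: the least number of simple generators whose product is `x`. -/
noncomputable def affLen (k : ℕ) (x : Equiv.Perm ℤ) : ℕ :=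
  sInf {n : ℕ | ∃ w : List (ZMod (k + 1)), w.length = n ∧ x = (w.map (sAff k)).prod}

/-- The right descent set `D_R(x) = {i : ℓ(x s_i) < ℓ(x)}`. -/
noncomputable def rightDescents (k : ℕ) (x : Equiv.Perm ℤ) : Set (ZMod (k + 1)) :=
  {i | affLen k (x * sAff k i) < affLen k x}

/-- The cyclic interval `[i,j] = {i, i+1, …, j}` of residues mod `k+1`. -/
def cycInt (k : ℕ) (i j : ZMod (k + 1)) : Finset (ZMod (k + 1)) :=
  (Finset.range ((j - i).val + 1)).image fun t : ℕ => i + (t : ZMod (k + 1))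

/-- A choice of a "gate" residue not belonging to `A` (when `A` is proper). -/
noncomputable def gate (k : ℕ) (A : Finset (ZMod (k + 1))) : ZMod (k + 1) :=
  if h : ∃ g, g ∉ A then h.choose else 0

/-- The cyclically decreasing element `d_A`: the product of the `s_a`, `a ∈ A`, in an
order where `s_{a+1}` occurs to the left of `s_a` whenever `a, a+1 ∈ A`. -/
noncomputable def dElt (k : ℕ) (A : Finset (ZMod (k + 1))) : Equiv.Perm ℤ :=
  (((((List.range (k + 1)).reverse.map fun t : ℕ => gate k A + (t : ZMod (k + 1))).filter
      fun a => decide (a ∈ A)).map (sAff k)).prod)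

/-- The cyclically increasing element `u_A`: the product of the `s_a`, `a ∈ A`, in an
order where `s_{a+1}` occurs to the right of `s_a` whenever `a, a+1 ∈ A`. -/
noncomputable def uElt (k : ℕ) (A : Finset (ZMod (k + 1))) : Equiv.Perm ℤ :=
  ((((List.range (k + 1)).map fun t : ℕ => gate k A + (t : ZMod (k + 1))).filter
      fun a => decide (a ∈ A)).map (sAff k)).prod

/-- The right decreasing code: `CRD(x)_i = #{j < ī : x(j) > x(ī)}`. -/
noncomputable def CRD (k : ℕ) (x : Equiv.Perm ℤ) (i : ZMod (k + 1)) : ℕ :=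
  Set.ncard {j : ℤ | j < (i.val : ℤ) ∧ x (i.val : ℤ) < x j}

/-- The right increasing code: `CRI(x)_i = #{j > ī + 1 : x(j) < x(ī + 1)}`. -/
noncomputable def CRI (k : ℕ) (x : Equiv.Perm ℤ) (i : ZMod (k + 1)) : ℕ :=
  Set.ncard {j : ℤ | (i.val : ℤ) + 1 < j ∧ x j < x ((i.val : ℤ) + 1)}

/-- The left decreasing code: `CLD(x)_i = #{j < x⁻¹(ī + 1) : x(j) > ī + 1}`. -/
noncomputable def CLD (k : ℕ) (x : Equiv.Perm ℤ) (i : ZMod (k + 1)) : ℕ :=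
  Set.ncard {j : ℤ | j < x.symm ((i.val : ℤ) + 1) ∧ (i.val : ℤ) + 1 < x j}

/-- The left increasing code: `CLI(x)_i = #{j > x⁻¹(ī) : x(j) < ī}`. -/
noncomputable def CLI (k : ℕ) (x : Equiv.Perm ℤ) (i : ZMod (k + 1)) : ℕ :=
  Set.ncard {j : ℤ | x.symm ((i.val : ℤ)) < j ∧ x j < (i.val : ℤ)}

theorem affLen_prod_le (k : ℕ) (w : List (ZMod (k + 1))) :
    affLen k (w.map (sAff k)).prod ≤ w.length :=
  Nat.sInf_le ⟨w, rfl, rfl⟩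

theorem natCast_zmod_ne_zero {k d : ℕ} (h0 : 0 < d) (hd : d ≤ k) : (d : ZMod (k + 1)) ≠ 0 := by
  rw [Ne, ZMod.natCast_eq_zero_iff]
  exact fun h => absurd (Nat.le_of_dvd h0 h) (by omega)

theorem one_zmod_ne_zero {k : ℕ} (hk : 1 ≤ k) : (1 : ZMod (k + 1)) ≠ 0 := by
  simpa using natCast_zmod_ne_zero (d := 1) one_pos hk

theorem sAff_apply {k : ℕ} (hk : 1 ≤ k) (i : ZMod (k + 1)) (j : ℤ) :
    sAff k i j = if (j : ZMod (k + 1)) = i then j + 1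
      else if (j : ZMod (k + 1)) = i + 1 then j - 1 else j := by
  rw [sAff, dif_neg (one_zmod_ne_zero hk)]
  rfl

theorem sAff_mul_self {k : ℕ} (hk : 1 ≤ k) (i : ZMod (k + 1)) : sAff k i * sAff k i = 1 := by
  ext j
  rw [sAff, dif_neg (one_zmod_ne_zero hk)]
  exact sAffFun_invol k i (one_zmod_ne_zero hk) j

theorem sAff_commute {k : ℕ} (i : ZMod (k + 1)) {d : ℕ} (h2 : 2 ≤ d) (hd : d + 1 ≤ k) :
    Commute (sAff k i) (sAff k (i + d)) := by
  have h0 : (d : ZMod (k + 1)) ≠ 0 := natCast_zmod_ne_zero (by omega) (by omega)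
  have h1 : (d : ZMod (k + 1)) - 1 ≠ 0 := by
    have := natCast_zmod_ne_zero (k := k) (d := d - 1) (by omega) (by omega)
    rwa [Nat.cast_sub (by omega), Nat.cast_one] at this
  have h3 : (d : ZMod (k + 1)) + 1 ≠ 0 := by
    simpa using natCast_zmod_ne_zero (k := k) (d := d + 1) (by omega) (by omega)
  have h4 : (1 : ZMod (k + 1)) ≠ 0 := one_zmod_ne_zero (by omega)
  ext j
  simp only [Equiv.Perm.mul_apply, sAff_apply (by omega : 1 ≤ k)]
  split_ifs <;> push_cast at * <;> grind

theorem sAff_braid {k : ℕ} (hk : 2 ≤ k) (i : ZMod (k + 1)) :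
    sAff k (i + 1) * sAff k i * sAff k (i + 1) = sAff k i * sAff k (i + 1) * sAff k i := by
  have h1 : (1 : ZMod (k + 1)) ≠ 0 := one_zmod_ne_zero (by omega)
  have h2 : (2 : ZMod (k + 1)) ≠ 0 := by
    simpa using natCast_zmod_ne_zero (d := 2) two_pos hk
  have h3 : (2 : ZMod (k + 1)) ≠ 1 := fun h => h1 (by linear_combination h)
  ext j
  simp only [Equiv.Perm.mul_apply, sAff_apply (by omega : 1 ≤ k)]
  by_cases e0 : (j : ZMod (k + 1)) = i
  · simp [e0, h1, h2, h3, add_assoc, one_add_one_eq_two]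
  by_cases e1 : (j : ZMod (k + 1)) = i + 1
  · simp [e1, h1, h2, h3, add_assoc, one_add_one_eq_two]
  by_cases e2 : (j : ZMod (k + 1)) = i + 2
  · have : i + 2 - 1 = i + 1 := by ring
    simp [e2, h1, h2, h3, add_assoc, one_add_one_eq_two, this]
  · simp [e0, e1, e2, add_assoc, one_add_one_eq_two]

/-- The product `s (m - 1) * ⋯ * s 1 * s 0`. -/
def descProd {G : Type*} [Monoid G] (s : ℕ → G) (m : ℕ) : G :=
  ((List.range m).reverse.map s).prod

section DescProd

variable {G : Type*} [Monoid G] (s : ℕ → G)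

theorem descProd_succ (m : ℕ) : descProd s (m + 1) = s m * descProd s m := by
  simp [descProd, List.range_succ]

theorem descProd_succ' (m : ℕ) :
    descProd s (m + 1) = descProd (fun i => s (i + 1)) m * s 0 := by
  simp [descProd, List.range_succ_eq_map, Function.comp_def]

theorem commute_descProd {m : ℕ} {x : G} (h : ∀ i < m, Commute x (s i)) :
    Commute x (descProd s m) := by
  refine Commute.list_prod_right _ _ fun y hy => ?_
  simp only [List.mem_map, List.mem_reverse, List.mem_range] at hy
  obtain ⟨i, hi, rfl⟩ := hy
  exact h i hi

theorem descProd_mul_shift {m : ℕ}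
    (hc : ∀ i j, i + 2 ≤ j → j ≤ m → Commute (s i) (s j))
    (hb : ∀ i, i + 1 ≤ m → s (i + 1) * s i * s (i + 1) = s i * s (i + 1) * s i) :
    descProd s (m + 1) * descProd (fun i => s (i + 1)) m =
      descProd s m * descProd s (m + 1) := by
  induction m with
  | zero => simp [descProd]
  | succ m ih =>
    have ih := ih (fun i j h h' => hc i j h (by omega)) fun i h => hb i (by omega)
    have hcomm : Commute (s (m + 1)) (descProd s m) :=
      commute_descProd s fun i hi => (hc i (m + 1) (by omega) le_rfl).symm
    have hbr := hb m le_rfl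
    set U := descProd (fun i => s (i + 1)) m
    have e : descProd (fun i => s (i + 1)) (m + 1) = s (m + 1) * U := descProd_succ _ m
    calc descProd s (m + 1 + 1) * descProd (fun i => s (i + 1)) (m + 1)
        = s (m + 1) * s m * (descProd s m * s (m + 1)) * U := by
          rw [e, descProd_succ s (m + 1), descProd_succ s m]; simp only [mul_assoc]
      _ = s (m + 1) * s m * s (m + 1) * (descProd s m * U) := by
          rw [← hcomm.eq]; simp only [mul_assoc]
      _ = s m * s (m + 1) * (descProd s (m + 1) * U) := by
          rw [hbr, descProd_succ s m]; simp only [mul_assoc]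
      _ = s m * (s (m + 1) * descProd s m) * descProd s (m + 1) := by
          rw [ih]; simp only [mul_assoc]
      _ = descProd s (m + 1) * descProd s (m + 1 + 1) := by
          rw [hcomm.eq, descProd_succ s (m + 1), ← mul_assoc (s m), ← descProd_succ s m, mul_assoc]

theorem descProd_mul_self {m : ℕ}
    (hc : ∀ i j, i + 2 ≤ j → j ≤ m → Commute (s i) (s j))
    (hb : ∀ i, i + 1 ≤ m → s (i + 1) * s i * s (i + 1) = s i * s (i + 1) * s i)
    (h0 : s 0 * s 0 = 1) :
    descProd s (m + 1) * descProd s (m + 1) =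
      descProd s m * descProd (fun i => s (i + 1)) m := by
  calc descProd s (m + 1) * descProd s (m + 1)
      = descProd s (m + 1) * descProd (fun i => s (i + 1)) m * s 0 := by
        nth_rw 2 [descProd_succ' s m]; rw [mul_assoc]
    _ = _ := by
        rw [descProd_mul_shift s hc hb, descProd_succ' s m]
        simp only [mul_assoc, h0, mul_one]

end DescProd

theorem gate_notMem {k : ℕ} {A : Finset (ZMod (k + 1))} (hA : A ≠ Finset.univ) :
    gate k A ∉ A := by
  have h : ∃ g, g ∉ A := by
    by_contra! h
    exact hA (Finset.eq_univ_iff_forall.2 h)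
  rw [gate, dif_pos h]
  exact h.choose_spec

/-- Splitting `d_A` around a run `c, c + 1, …, c + t - 1` of elements of `A`. -/
theorem dElt_eq_around_run {k : ℕ} {A : Finset (ZMod (k + 1))} (hA : A ≠ Finset.univ)
    {c : ZMod (k + 1)} {t : ℕ} (ht : 0 < t) (hrun : ∀ i < t, c + i ∈ A) :
    t ≤ k ∧ ∃ L R : List (ZMod (k + 1)),
      dElt k A = (L.map (sAff k)).prod * descProd (fun i => sAff k (c + i)) t *
        (R.map (sAff k)).prod ∧
      L.length + t + R.length ≤ A.card ∧
      (c + t ∉ A → ∀ a ∈ L, ∀ i < t, Commute (sAff k a) (sAff k (c + i))) ∧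
      (c - 1 ∉ A → ∀ a ∈ R, ∀ i < t, Commute (sAff k a) (sAff k (c + i))) := by
  have hg := gate_notMem hA
  set g := gate k A
  obtain ⟨p, hp, rfl⟩ : ∃ p < k + 1, c = g + (p : ℕ) :=
    ⟨(c - g).val, ZMod.val_lt _, by rw [ZMod.natCast_zmod_val]; ring⟩
  have hp0 : 1 ≤ p := by
    by_contra! h
    obtain rfl : p = 0 := by omega
    exact hg (by simpa using hrun 0 ht)
  have hpt : p + t ≤ k + 1 := by
    by_contra! h
    refine hg ?_
    have := hrun (k + 1 - p) (by omega)
    rwa [add_assoc, ← Nat.cast_add, Nat.add_sub_cancel' hp.le, ZMod.natCast_self,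
      add_zero] at this
  obtain ⟨r, hr⟩ := Nat.exists_eq_add_of_le hpt
  let f : ℕ → ZMod (k + 1) := fun q => g + q
  let P : ZMod (k + 1) → Bool := fun a => decide (a ∈ A)
  let L := (((List.range r).map fun q => p + t + q).reverse.map f).filter P
  let M := ((List.range t).reverse.map fun i : ℕ => g + (p : ZMod (k + 1)) + i)
  let R := ((List.range p).reverse.map f).filter P
  have hM : (((List.range t).map fun q => p + q).reverse.map f).filter P = M := by
    rw [← List.map_reverse, List.map_map, List.filter_eq_self.2]
    · simp [M, f, Function.comp_def, add_assoc]
    · intro a ha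
      simp only [List.mem_map, List.mem_reverse, List.mem_range, Function.comp_def] at ha
      obtain ⟨i, hi, rfl⟩ := ha
      simpa [P, f, add_assoc] using hrun i hi
  have hword : ((List.range (k + 1)).reverse.map f).filter P = L ++ M ++ R := by
    have hrange : List.range (k + 1) = List.range p ++ (List.range t).map (fun q => p + q) ++
        (List.range r).map (fun q => p + t + q) := by
      rw [← List.range_add, ← List.range_add, ← hr]
    simp only [hrange, List.reverse_append, List.map_append, List.filter_append, hM, L, R,
      List.append_assoc]
  refine ⟨by omega, L, R, ?_, ?_, ?_, ?_⟩
  · have : dElt k A = ((((List.range (k + 1)).reverse.map f).filter P).map (sAff k)).prod := rfl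
    rw [this, hword]
    simp [M, descProd, List.map_map, Function.comp_def, mul_assoc]
  · have hnd : (((List.range (k + 1)).reverse.map f).filter P).Nodup := by
      refine List.Nodup.filter _ (List.Nodup.map_on ?_ (by simpa using List.nodup_range))
      intro x hx y hy hxy
      simp only [List.mem_reverse, List.mem_range] at hx hy
      have := congrArg ZMod.val (add_left_cancel hxy)
      rwa [ZMod.val_natCast_of_lt hx, ZMod.val_natCast_of_lt hy] at this
    have hle : (L ++ M ++ R).length ≤ A.card := by
      rw [hword] at hnd
      rw [← List.toFinset_card_of_nodup hnd, ← hword]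
      refine Finset.card_le_card fun a ha => ?_
      simpa [P] using (List.mem_filter.1 (List.mem_toFinset.1 ha)).2
    simpa [M, add_assoc] using hle
  · intro hc a ha i hi
    simp only [L, P, f, List.mem_filter, List.mem_map, List.mem_reverse, List.mem_range,
      decide_eq_true_eq] at ha
    obtain ⟨⟨_, ⟨q, hq, rfl⟩, rfl⟩, ha⟩ := ha
    have hq0 : q ≠ 0 := by
      rintro rfl
      exact hc (by simpa [add_assoc] using ha)
    have := sAff_commute (k := k) (g + p + i) (d := t + q - i) (by omega) (by omega)
    have e : g + p + i + ((t + q - i : ℕ) : ZMod (k + 1)) = g + ((p + t + q : ℕ) : ZMod (k + 1)) := by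
      rw [Nat.cast_sub (by omega)]; push_cast; ring
    rw [e] at this
    exact this.symm
  · intro hc a ha i hi
    simp only [R, P, f, List.mem_filter, List.mem_map, List.mem_reverse, List.mem_range,
      decide_eq_true_eq] at ha
    obtain ⟨⟨q, hq, rfl⟩, ha⟩ := ha
    have hq0 : q ≠ 0 := by
      rintro rfl
      exact hg (by simpa using ha)
    have hq1 : q + 1 ≠ p := by
      rintro rfl
      refine hc ?_
      convert ha using 1
      push_cast
      ring
    have := sAff_commute (k := k) (g + q) (d := p + i - q) (by omega) (by omega)
    have e : g + q + ((p + i - q : ℕ) : ZMod (k + 1)) = g + p + i := by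
      rw [Nat.cast_sub (by omega)]; push_cast; ring
    rwa [e] at this

theorem commute_list_descProd {k : ℕ} {c : ZMod (k + 1)} {t : ℕ} {L : List (ZMod (k + 1))}
    (h : ∀ a ∈ L, ∀ i < t, Commute (sAff k a) (sAff k (c + i))) :
    Commute (L.map (sAff k)).prod (descProd (fun i => sAff k (c + i)) t) := by
  refine Commute.list_prod_left _ _ fun y hy => ?_
  obtain ⟨a, ha, rfl⟩ := List.mem_map.1 hy
  exact commute_descProd _ (h a ha)

/-- If no column is empty, some run of `A ∩ B` starts where a run of `B` starts and ends where
a run of `A` ends. -/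
theorem exists_common_run {k : ℕ} {A B : Finset (ZMod (k + 1))} (hA : A ≠ Finset.univ)
    (hB : B ≠ Finset.univ) (h : ∀ j, j ∉ A → j - 1 ∈ B) :
    ∃ (c : ZMod (k + 1)) (t : ℕ), 0 < t ∧ c - 1 ∉ B ∧ c + t ∉ A ∧
      (∀ i < t, c + i ∈ A) ∧ ∀ i < t, c + i ∈ B := by
  classical
  have hex : ∃ t : ℕ, ∃ c : ZMod (k + 1), c - 1 ∉ B ∧ c + t ∉ A := by
    refine ⟨(gate k A - (gate k B + 1)).val, gate k B + 1, ?_, ?_⟩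
    · simpa using gate_notMem hB
    · simpa [ZMod.natCast_zmod_val] using gate_notMem hA
  obtain ⟨c, hcB, hcA⟩ := Nat.find_spec hex
  have hmin : ∀ i < Nat.find hex, ∀ d : ZMod (k + 1), d - 1 ∉ B → d + i ∈ A := fun i hi d hd => by
    by_contra hdA
    exact Nat.find_min hex hi ⟨d, hd, hdA⟩
  refine ⟨c, Nat.find hex, ?_, hcB, hcA, fun i hi => hmin i hi c hcB, fun i hi => ?_⟩
  · rw [Nat.pos_iff_ne_zero]
    intro h0
    rw [h0] at hcA
    exact hcB (h c (by simpa using hcA))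
  · by_contra hiB
    refine hcA ?_
    have := hmin (Nat.find hex - (i + 1)) (by omega) (c + i + 1) (by simpa using hiB)
    rw [Nat.cast_sub (by omega)] at this
    convert this using 1
    push_cast
    ring

/-- if `d_B d_A` is reduced, there is an "empty column", i.e. a residue
`j` with `j ∉ A` and `j − 1 ∉ B`. -/
theorem two_row_empty_column (k : ℕ) (hk : 1 ≤ k) (A B : Finset (ZMod (k + 1)))
    (hA : A ≠ Finset.univ) (hB : B ≠ Finset.univ)
    (hred : affLen k (dElt k B * dElt k A) = A.card + B.card) :
    ∃ j : ZMod (k + 1), j ∉ A ∧ j - 1 ∉ B := by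
  by_contra! h
  obtain ⟨c, t, ht, hcB, hcA, htA, htB⟩ := exists_common_run hA hB h
  obtain ⟨htk, L, R, hdA, hlenA, hcommA, -⟩ := dElt_eq_around_run hA ht htA
  obtain ⟨-, L', R', hdB, hlenB, -, hcommB⟩ := dElt_eq_around_run hB ht htB
  have hL := (commute_list_descProd (hcommA hcA)).eq
  have hR := (commute_list_descProd (hcommB hcB)).eq
  obtain ⟨m, rfl⟩ : ∃ m, t = m + 1 := ⟨t - 1, by omega⟩
  have hsq := descProd_mul_self (fun i : ℕ => sAff k (c + i)) (m := m)
    (fun i j hij hj => by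
      have := sAff_commute (k := k) (c + i) (d := j - i) (by omega) (by omega)
      rwa [Nat.cast_sub (by omega), add_assoc, add_sub_cancel] at this)
    (fun i hi => by simpa [add_assoc] using sAff_braid (k := k) (by omega) (c + i))
    (sAff_mul_self hk _)
  set D := descProd (fun i : ℕ => sAff k (c + i)) (m + 1)
  let w := L' ++ R' ++ (List.range m).reverse.map (fun i : ℕ => c + (i : ZMod (k + 1))) ++
    (List.range m).reverse.map (fun i : ℕ => c + ((i + 1 : ℕ) : ZMod (k + 1))) ++ L ++ R
  have hw : dElt k B * dElt k A = (w.map (sAff k)).prod := by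
    calc dElt k B * dElt k A
        = (L'.map (sAff k)).prod * (R'.map (sAff k)).prod * (D * D) *
            (L.map (sAff k)).prod * (R.map (sAff k)).prod := by
          rw [hdA, hdB, hL, mul_assoc _ D, ← hR]
          simp only [mul_assoc]
      _ = (w.map (sAff k)).prod := by
          rw [hsq]
          simp only [w, descProd, List.map_append, List.prod_append, List.map_map, mul_assoc,
            Function.comp_def]
  have hle := affLen_prod_le k w
  rw [← hw, hred] at hle
  simp only [w, List.length_append, List.length_map, List.length_reverse, List.length_range] at hle
  omega
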